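/- Define p : ℝ → ℝ by p(t) = 1 + 1/(1+|t|) and u : ℝ → ℝ by u(t) = (1/e)(1 − e^{−t}) for t ≥ 0 and u(t) = −(1/e)(1 − e^{t}) for t < 0. Then u is continuously differentiable on ℝ, bounded, nonconstant, and p(·)-harmonic on ℝ, i.e. ∫_ℝ |u'(t)|^{p(t)−2} u'(t) φ'(t) dt = 0 for every smooth compactly supported φ : ℝ → ℝ. -/

import Mathlib

open MeasureTheory Real
open scoped ContDiff

noncomputable section

/-- The variable exponent `p(t) = 1 + 1/(1+|t|)`. -/
def p01 : ℝ → ℝ := fun t => 1 + 1 / (1 + |t|)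

/-- `u(t) = (1/e)(1 − e^{−t})` for `t ≥ 0` and `u(t) = −(1/e)(1 − e^{t})` for `t < 0`. -/
def u01 : ℝ → ℝ := fun t =>
  if 0 ≤ t then (1 / Real.exp 1) * (1 - Real.exp (-t))
  else -((1 / Real.exp 1) * (1 - Real.exp t))

theorem u01_hasDerivAt (t : ℝ) : HasDerivAt u01 (Real.exp (-(1 + |t|))) t := by
  have h1 : ∀ s : ℝ, HasDerivAt (fun t : ℝ => (1 / Real.exp 1) * (1 - Real.exp (-t)))
      (Real.exp (-(1 + s))) s := by
    intro s
    have := (((hasDerivAt_neg s).exp).const_sub 1).const_mul (1 / Real.exp 1)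
    refine HasDerivAt.congr_deriv this ?_
    rw [neg_add, Real.exp_add, Real.exp_neg 1]
    ring
  have h2 : ∀ s : ℝ, HasDerivAt (fun t : ℝ => -((1 / Real.exp 1) * (1 - Real.exp t)))
      (Real.exp (-(1 - s))) s := by
    intro s
    have := (((Real.hasDerivAt_exp s).const_sub 1).const_mul (1 / Real.exp 1)).neg
    refine HasDerivAt.congr_deriv this ?_
    rw [neg_sub, sub_eq_add_neg, Real.exp_add, Real.exp_neg 1]
    ring
  have e1 : ∀ s ∈ Set.Ici (0:ℝ), u01 s = (1 / Real.exp 1) * (1 - Real.exp (-s)) := by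
    intro s hs
    simp only [u01]
    rw [if_pos (Set.mem_Ici.1 hs)]
  have e2 : ∀ s ∈ Set.Iic (0:ℝ), u01 s = -((1 / Real.exp 1) * (1 - Real.exp s)) := by
    intro s hs
    rcases eq_or_lt_of_le (Set.mem_Iic.1 hs) with h | h
    · subst h
      simp [u01]
    · simp only [u01]
      rw [if_neg (not_le.2 h)]
  rcases lt_trichotomy t 0 with h | h | h
  · have := (h2 t).congr_of_eventuallyEq (f₁ := u01) (by
      filter_upwards [Iio_mem_nhds h] with s hs using e2 s (Set.mem_Iic.2 (le_of_lt hs)))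
    rwa [abs_of_neg h, ← sub_eq_add_neg]
  · subst h
    have a := ((h1 0).hasDerivWithinAt (s := Set.Ici 0)).congr e1 (e1 0 (by simp))
    have b := ((h2 0).hasDerivWithinAt (s := Set.Iic 0)).congr e2 (e2 0 (by simp))
    rw [abs_zero]
    rw [sub_zero] at b
    rw [add_zero] at a ⊢
    have := b.union a
    rwa [Set.Iic_union_Ici, hasDerivWithinAt_univ] at this
  · have := (h1 t).congr_of_eventuallyEq (f₁ := u01) (by
      filter_upwards [Ioi_mem_nhds h] with s hs using e1 s (Set.mem_Ici.2 (le_of_lt hs)))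
    rwa [abs_of_pos h]

/-- `u01` is a nonconstant bounded `C¹` function which is `p01(·)`-harmonic on `ℝ`. -/
theorem u01_nonconstant_bounded_p01_harmonic :
    ContDiff ℝ 1 u01 ∧
    (∃ M : ℝ, ∀ t : ℝ, |u01 t| ≤ M) ∧
    (¬ ∃ c : ℝ, ∀ t : ℝ, u01 t = c) ∧
    (∀ φ : ℝ → ℝ, ContDiff ℝ ∞ φ → HasCompactSupport φ →
      ∫ t : ℝ, |deriv u01 t| ^ (p01 t - 2) * deriv u01 t * deriv φ t = 0) := by
  have hd : deriv u01 = fun t => Real.exp (-(1 + |t|)) :=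
    funext fun t => (u01_hasDerivAt t).deriv
  have he : 1 / Real.exp 1 ≤ 1 := by
    rw [div_le_one (Real.exp_pos 1)]
    exact Real.one_le_exp zero_le_one
  have he0 : 0 < 1 / Real.exp 1 := by positivity
  refine ⟨?_, ⟨1, fun t => ?_⟩, ?_, ?_⟩
  · rw [contDiff_one_iff_deriv]
    refine ⟨fun t => (u01_hasDerivAt t).differentiableAt, ?_⟩
    rw [hd]
    fun_prop
  · simp only [u01]
    split_ifs with h
    · have h1 : Real.exp (-t) ≤ 1 := Real.exp_le_one_iff.2 (by linarith)
      have h2 := Real.exp_pos (-t)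
      rw [abs_of_nonneg (mul_nonneg he0.le (by linarith))]
      nlinarith
    · have h1 : Real.exp t ≤ 1 := Real.exp_le_one_iff.2 (by linarith)
      have h2 := Real.exp_pos t
      rw [abs_neg, abs_of_nonneg (mul_nonneg he0.le (by linarith))]
      nlinarith
  · rintro ⟨c, hc⟩
    have h : u01 = fun _ => c := funext hc
    have h0 := congrFun hd 0
    rw [h] at h0
    simp only [deriv_const] at h0
    exact (Real.exp_pos _).ne h0
  · intro φ hφ hc
    have hi : ∀ t : ℝ, |deriv u01 t| ^ (p01 t - 2) * deriv u01 t * deriv φ t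
        = Real.exp (-1) * deriv φ t := by
      intro t
      rw [hd]
      simp only [p01]
      rw [abs_of_pos (Real.exp_pos _), ← Real.exp_mul, ← Real.exp_add]
      congr 2
      have : (1 + |t|) ≠ 0 := by positivity
      field_simp
      ring
    simp_rw [hi]
    rw [integral_const_mul]
    have hcd : Continuous (deriv φ) := hφ.continuous_deriv (by simp)
    have hz : ∫ t : ℝ, deriv φ t = 0 :=
      integral_eq_zero_of_hasDerivAt_of_integrable
        (fun x => ((hφ.differentiable (by simp)) x).hasDerivAt)
        (hcd.integrable_of_hasCompactSupport hc.deriv)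
        (hφ.continuous.integrable_of_hasCompactSupport hc)
    rw [hz, mul_zero]

end
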